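/- Let n ≥ 1, let Ω = I_n ⊗ [[0,1],[-1,0]], let S be a real symplectic 2n×2n matrix, let ν₁,…,ν_n be reals with each ν_j > 1, let D := diag(ν₁,…,ν_n) ⊗ I₂, E := diag(√(1-ν₁⁻²),…,√(1-ν_n⁻²)) ⊗ I₂, V := SᵀDS and R := Sᵀ E S⁻ᵀ. Let V₀ be a real symmetric 2n×2n matrix such that the complex Hermitian matrix V₀ + iΩ is positive definite and V − V₀ is positive definite, and define V₄ := −V + R V (V − V₀)⁻¹ V Rᵀ. Then det((V₄ + iΩ)/2) = det((V + iΩ)/2) · det((V₀ + iΩ)/2) / det((V − V₀)/2), where determinants of the matrices W ± iΩ are taken over the complex numbers. -/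

import Mathlib

open Matrix
open scoped Kronecker ComplexOrder

noncomputable section

/-- The `2n × 2n` standard symplectic form `Ω = I_n ⊗ [[0,1],[-1,0]]`. -/
def Omega (n : ℕ) : Matrix (Fin n × Fin 2) (Fin n × Fin 2) ℝ :=
  (1 : Matrix (Fin n) (Fin n) ℝ) ⊗ₖ !![(0 : ℝ), 1; -1, 0]

/-- Complexification of a real `2n × 2n` matrix. -/
def cmat {n : ℕ} (M : Matrix (Fin n × Fin 2) (Fin n × Fin 2) ℝ) :
    Matrix (Fin n × Fin 2) (Fin n × Fin 2) ℂ :=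
  M.map Complex.ofReal

/-- If `F² = AB` with `F` invertible and commuting with `B`, and `Q = P⁻¹`, then
`det (F S Q Sᵀ F - B) = det Q * det (Sᵀ A S - P) * det B`. -/
theorem det_mul_inv_mul_sub {ι K : Type*} [Fintype ι] [DecidableEq ι] [Field K]
    {F A B S P Q : Matrix ι ι K} (hF : F.det ≠ 0) (hS : S.det ≠ 0) (hFF : F * F = A * B)
    (hFB : F * B = B * F) (hQP : Q * P = 1) :
    (F * (S * Q * Sᵀ) * F - B).det = Q.det * (Sᵀ * A * S - P).det * B.det := by
  have h₁ : (F * (S * Q * Sᵀ) * F - B) * F = F * (S * Q * Sᵀ * A - 1) * B := by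
    calc _ = F * (S * Q * Sᵀ) * (F * F) - B * F := by noncomm_ring
      _ = F * (S * Q * Sᵀ) * (A * B) - F * B := by rw [hFF, hFB]
      _ = _ := by noncomm_ring
  have h₂ : (S * Q * Sᵀ * A - 1) * S = S * (Q * (Sᵀ * A * S - P)) := by
    rw [mul_sub Q, hQP]
    noncomm_ring
  have d₁ := congrArg det h₁
  have d₂ := congrArg det h₂
  simp only [det_mul] at d₁ d₂
  have d₃ : (S * Q * Sᵀ * A - 1).det = Q.det * (Sᵀ * A * S - P).det :=
    mul_right_cancel₀ hS (by rw [d₂]; ring)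
  rw [← d₃]
  exact mul_right_cancel₀ hF (by rw [d₁]; ring)

theorem Omega_mul_Omega (n : ℕ) : Omega n * Omega n = -1 := by
  have h : (!![(0 : ℝ), 1; -1, 0] * !![(0 : ℝ), 1; -1, 0]) = (-1 : ℝ) • 1 := by
    ext i j
    fin_cases i <;> fin_cases j <;> simp
  rw [Omega, ← mul_kronecker_mul, h, one_mul, kronecker_smul, one_kronecker_one, neg_one_smul]

theorem transpose_Omega (n : ℕ) : (Omega n)ᵀ = -Omega n := by
  have h : !![(0 : ℝ), 1; -1, 0]ᵀ = (-1 : ℝ) • !![(0 : ℝ), 1; -1, 0] := by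
    ext i j
    fin_cases i <;> fin_cases j <;> simp
  rw [Omega, ← kroneckerMap_transpose, h, transpose_one, kronecker_smul, neg_one_smul]

theorem diagonal_kronecker_one_commute_Omega {n : ℕ} (d : Fin n → ℝ) :
    (diagonal d ⊗ₖ (1 : Matrix (Fin 2) (Fin 2) ℝ)) * Omega n =
      Omega n * (diagonal d ⊗ₖ (1 : Matrix (Fin 2) (Fin 2) ℝ)) := by
  simp only [Omega, ← mul_kronecker_mul, one_mul, mul_one]

theorem det_ne_zero_of_symplectic {n : ℕ} {S : Matrix (Fin n × Fin 2) (Fin n × Fin 2) ℝ}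
    (hS : Sᵀ * Omega n * S = Omega n) : S.det ≠ 0 := by
  have hΩ : (Omega n).det ≠ 0 := by
    intro h
    have := congrArg det (Omega_mul_Omega n)
    simp [det_mul, h, det_neg] at this
  intro h
  apply hΩ
  rw [← hS, det_mul, h, mul_zero]

section Complexification

variable {n : ℕ} (M N : Matrix (Fin n × Fin 2) (Fin n × Fin 2) ℝ)

theorem cmat_mul : cmat (M * N) = cmat M * cmat N :=
  map_mul Complex.ofRealHom.mapMatrix M N

theorem cmat_add : cmat (M + N) = cmat M + cmat N :=
  map_add Complex.ofRealHom.mapMatrix M N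

theorem cmat_sub : cmat (M - N) = cmat M - cmat N :=
  map_sub Complex.ofRealHom.mapMatrix M N

theorem cmat_neg : cmat (-M) = -cmat M :=
  map_neg Complex.ofRealHom.mapMatrix M

theorem cmat_one : cmat (1 : Matrix (Fin n × Fin 2) (Fin n × Fin 2) ℝ) = 1 :=
  map_one Complex.ofRealHom.mapMatrix

theorem cmat_transpose : cmat Mᵀ = (cmat M)ᵀ :=
  transpose_map

theorem det_cmat : (cmat M).det = (M.det : ℂ) :=
  (RingHom.map_det Complex.ofRealHom M).symm

end Complexification

/-- With `V = SᵀDS` in Williamson form, `R = √(I + (VΩ)⁻²)`, `V₀` real symmetric with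
`V₀ + iΩ` and `V − V₀` positive definite, and `V₄ := −V + R V (V − V₀)⁻¹ V Rᵀ`, one has
`det((V₄+iΩ)/2) = det((V+iΩ)/2) · det((V₀+iΩ)/2) / det((V−V₀)/2)`. -/
theorem det_V4_plus_iOmega (n : ℕ) (hn : 1 ≤ n)
    (S : Matrix (Fin n × Fin 2) (Fin n × Fin 2) ℝ)
    (hS : Sᵀ * Omega n * S = Omega n)
    (ν : Fin n → ℝ) (hν : ∀ j, 1 < ν j)
    (D E V R : Matrix (Fin n × Fin 2) (Fin n × Fin 2) ℝ)
    (hD : D = (Matrix.diagonal ν) ⊗ₖ (1 : Matrix (Fin 2) (Fin 2) ℝ))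
    (hE : E = (Matrix.diagonal fun j => Real.sqrt (1 - ((ν j) ^ 2)⁻¹)) ⊗ₖ
      (1 : Matrix (Fin 2) (Fin 2) ℝ))
    (hV : V = Sᵀ * D * S)
    (hR : R = Sᵀ * E * (S⁻¹)ᵀ)
    (V₀ : Matrix (Fin n × Fin 2) (Fin n × Fin 2) ℝ) (hV₀symm : V₀.IsSymm)
    (hV₀ : (cmat V₀ + Complex.I • cmat (Omega n)).PosDef)
    (hVV₀ : (V - V₀).PosDef)
    (V₄ : Matrix (Fin n × Fin 2) (Fin n × Fin 2) ℝ)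
    (hV₄ : V₄ = -V + R * V * (V - V₀)⁻¹ * V * Rᵀ) :
    ((2 : ℂ)⁻¹ • (cmat V₄ + Complex.I • cmat (Omega n))).det =
      ((2 : ℂ)⁻¹ • (cmat V + Complex.I • cmat (Omega n))).det *
        ((2 : ℂ)⁻¹ • (cmat V₀ + Complex.I • cmat (Omega n))).det /
          ((((2 : ℝ)⁻¹ • (V - V₀)).det : ℂ)) := by
  have hS0 : S.det ≠ 0 := det_ne_zero_of_symplectic hS
  have hP0 : (V - V₀).det ≠ 0 := hVV₀.det_pos.ne'
  have hDt : Dᵀ = D := by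
    rw [hD, ← kroneckerMap_transpose, diagonal_transpose, transpose_one]
  have hEt : Eᵀ = E := by
    rw [hE, ← kroneckerMap_transpose, diagonal_transpose, transpose_one]
  have hED : E * D = D * E := by
    rw [hD, hE, ← mul_kronecker_mul, ← mul_kronecker_mul, diagonal_mul_diagonal,
      diagonal_mul_diagonal]
    simp only [mul_comm]
  have hDΩ : D * Omega n = Omega n * D := hD ▸ diagonal_kronecker_one_commute_Omega ν
  have hEΩ : E * Omega n = Omega n * E := hE ▸ diagonal_kronecker_one_commute_Omega _
  have hFF : E * D * (E * D) = D * D - 1 := by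
    refine eq_sub_of_add_eq ?_
    rw [hD, hE, ← one_kronecker_one]
    simp only [← mul_kronecker_mul, diagonal_mul_diagonal, mul_one]
    rw [← add_kronecker, ← diagonal_one (n := Fin n), diagonal_add]
    congr 2
    ext j
    have h1 := hν j
    have h2 : 0 ≤ 1 - ((ν j) ^ 2)⁻¹ := sub_nonneg.2 (inv_le_one_of_one_le₀ (by nlinarith))
    have h3 := Real.mul_self_sqrt h2
    calc _ = √(1 - ((ν j) ^ 2)⁻¹) * √(1 - ((ν j) ^ 2)⁻¹) * (ν j * ν j) + 1 := by ring
      _ = _ := by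
        rw [h3]
        field_simp
        ring
  have hF0 : (E * D).det ≠ 0 := by
    rw [hD, hE, ← mul_kronecker_mul, diagonal_mul_diagonal, mul_one, det_kronecker, det_diagonal,
      det_one, one_pow, mul_one]
    refine pow_ne_zero _ (Finset.prod_ne_zero_iff.2 fun j _ => ?_)
    have h1 := hν j
    have h2 : 0 < 1 - ((ν j) ^ 2)⁻¹ := sub_pos.2 (inv_lt_one_of_one_lt₀ (by nlinarith))
    exact mul_ne_zero (Real.sqrt_pos.2 h2).ne' (by linarith)
  have hRV : R * V = Sᵀ * (E * D) * S := by
    have h : (S⁻¹)ᵀ * Sᵀ = 1 := by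
      rw [← transpose_mul, mul_nonsing_inv S hS0.isUnit, transpose_one]
    calc R * V = Sᵀ * E * ((S⁻¹)ᵀ * Sᵀ) * D * S := by rw [hR, hV]; noncomm_ring
      _ = _ := by rw [h]; noncomm_ring
  have hVt : Vᵀ = V := by
    rw [hV, transpose_mul, transpose_mul, transpose_transpose, hDt, Matrix.mul_assoc]
  have hVR : V * Rᵀ = Sᵀ * (E * D) * S := by
    calc V * Rᵀ = (R * V)ᵀ := by rw [transpose_mul, hVt]
      _ = _ := by
        rw [hRV, transpose_mul, transpose_mul, transpose_mul, transpose_transpose, hDt, hEt, ← hED,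
          ← Matrix.mul_assoc]
  set A := cmat D + Complex.I • cmat (Omega n) with hA
  set B := cmat D - Complex.I • cmat (Omega n) with hB
  have hΩ : Complex.I • cmat (Omega n) = (cmat S)ᵀ * (Complex.I • cmat (Omega n)) * cmat S := by
    conv_lhs => rw [← hS]
    simp only [cmat_mul, cmat_transpose, mul_smul_comm, smul_mul_assoc]
  have hVA : cmat V + Complex.I • cmat (Omega n) = (cmat S)ᵀ * A * cmat S := by
    rw [hΩ, hV, cmat_mul, cmat_mul, cmat_transpose, hA]
    noncomm_ring
  have hV₀A : cmat V₀ + Complex.I • cmat (Omega n) =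
      (cmat S)ᵀ * A * cmat S - cmat (V - V₀) := by
    rw [← hVA, cmat_sub]
    abel
  have hV₄B : cmat V₄ + Complex.I • cmat (Omega n) = (cmat S)ᵀ *
      (cmat (E * D) * (cmat S * cmat (V - V₀)⁻¹ * (cmat S)ᵀ) * cmat (E * D) - B) * cmat S := by
    have h : V₄ = Sᵀ * (E * D * (S * (V - V₀)⁻¹ * Sᵀ) * (E * D) - D) * S := by
      calc V₄ = -V + R * V * (V - V₀)⁻¹ * (V * Rᵀ) := by rw [hV₄]; noncomm_ring
        _ = -(Sᵀ * D * S) + Sᵀ * (E * D) * S * (V - V₀)⁻¹ * (Sᵀ * (E * D) * S) := by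
          rw [hRV, hVR, ← hV]
        _ = _ := by noncomm_ring
    rw [hΩ, h, hB]
    simp only [cmat_mul, cmat_sub, cmat_transpose]
    noncomm_ring
  have hAB : B = Aᵀ := by
    rw [hA, hB, transpose_add, transpose_smul, ← cmat_transpose, ← cmat_transpose, hDt,
      transpose_Omega, cmat_neg, smul_neg, sub_eq_add_neg]
  have hDΩc : cmat D * cmat (Omega n) = cmat (Omega n) * cmat D := by
    rw [← cmat_mul, hDΩ, cmat_mul]
  have hFFc : cmat (E * D) * cmat (E * D) = A * B := by
    have hΩΩ : cmat (Omega n) * cmat (Omega n) = -1 := by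
      rw [← cmat_mul, Omega_mul_Omega, cmat_neg, cmat_one]
    rw [← cmat_mul, hFF, cmat_sub, cmat_mul, cmat_one, hA, hB, add_mul, mul_sub, mul_sub,
      mul_smul_comm, smul_mul_assoc, smul_mul_smul_comm, hDΩc, hΩΩ, Complex.I_mul_I, neg_one_smul]
    abel
  have hFBc : cmat (E * D) * B = B * cmat (E * D) := by
    have h₁ : E * D * D = D * (E * D) := by rw [hED, Matrix.mul_assoc, hED]
    have h₂ : E * D * Omega n = Omega n * (E * D) := by
      rw [Matrix.mul_assoc, hDΩ, ← Matrix.mul_assoc, hEΩ, Matrix.mul_assoc]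
    rw [hB, mul_sub, sub_mul, mul_smul_comm, smul_mul_assoc, ← cmat_mul, ← cmat_mul, h₁, h₂,
      cmat_mul D, cmat_mul (Omega n)]
  have hQP : cmat (V - V₀)⁻¹ * cmat (V - V₀) = 1 := by
    rw [← cmat_mul, nonsing_inv_mul _ hP0.isUnit, cmat_one]
  have hSc : (cmat S).det ≠ 0 := by
    rw [det_cmat]
    exact_mod_cast hS0
  have hFc : (cmat (E * D)).det ≠ 0 := by
    rw [det_cmat]
    exact_mod_cast hF0
  have hQ : (cmat (V - V₀)⁻¹).det = ((V - V₀).det : ℂ)⁻¹ := by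
    rw [det_cmat, det_nonsing_inv, Ring.inverse_eq_inv', Complex.ofReal_inv]
  have hPc : ((V - V₀).det : ℂ) ≠ 0 := by exact_mod_cast hP0
  simp only [det_smul]
  rw [hV₄B, det_mul, det_mul, det_mul_inv_mul_sub hFc hSc hFFc hFBc hQP, ← hV₀A, hVA, det_mul,
    det_mul, hAB, det_transpose, det_transpose, hQ]
  push_cast
  field_simp
end
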